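/- Let C₀ > 0, 0 < κ < 1 and N ≥ 1 a real number, and let w : ℝ³ → ℝ be Lipschitz with |∇w(x)| ≤ C₀/(1+|x|²) for almost every x ∈ ℝ³. Then ∫_{[−1/2,1/2]³} | ∇_x ( N·w(N^{1−κ}x) ) |² dx ≤ π² C₀² N^{1+κ}. (This is the paper's H¹-bound ∑_{p} p²|η_p|² = ∫ |∇η̌|² ≤ C N^{1+κ} for η̌(x) = −N w_ℓ(N^{1−κ}x), given the gradient bound |∇w_ℓ(x)| ≤ C/(x²+1).) -/

import Mathlib

open MeasureTheory

noncomputable section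

/-- The Euclidean norm on `Fin 3 → ℝ` (coordinates of a point of `ℝ³`). -/
def enorm3 (x : Fin 3 → ℝ) : ℝ := Real.sqrt (∑ k, (x k) ^ 2)

/-- The centered unit box `[−1/2,1/2]³` in `ℝ³`. -/
def boxSym : Set (Fin 3 → ℝ) := {x | ∀ k, x k ∈ Set.Icc (-(1 / 2) : ℝ) (1 / 2)}

open Set Filter Topology

lemma enorm3_eq_norm_toLp (x : Fin 3 → ℝ) : enorm3 x = ‖WithLp.toLp 2 x‖ := by
  simp [enorm3, EuclideanSpace.norm_eq]

lemma hasDerivAt_half_arctan_sub_div (r : ℝ) :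
    HasDerivAt (fun r : ℝ => (Real.arctan r - r / (1 + r ^ 2)) / 2)
      (r ^ 2 * ((1 + r ^ 2) ^ 2)⁻¹) r := by
  have h0 : (1 + r ^ 2 : ℝ) ≠ 0 := by positivity
  have hden : HasDerivAt (fun r : ℝ => 1 + r ^ 2) (2 * r) r := by
    simpa using (hasDerivAt_pow 2 r).const_add 1
  refine (((Real.hasDerivAt_arctan r).sub ((hasDerivAt_id r).div hden h0)).div_const 2).congr_deriv ?_
  simp only [id]
  field_simp
  ring

lemma tendsto_half_arctan_sub_div :
    Tendsto (fun r : ℝ => (Real.arctan r - r / (1 + r ^ 2)) / 2) atTop (𝓝 (Real.pi / 4)) := by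
  have h : Tendsto (fun r : ℝ => r / (1 + r ^ 2)) atTop (𝓝 0) := by
    refine squeeze_zero' ?_ ?_ tendsto_inv_atTop_zero
    · filter_upwards [eventually_gt_atTop 0] with r hr
      positivity
    · filter_upwards [eventually_gt_atTop 0] with r hr
      rw [div_le_iff₀ (by positivity), ← div_eq_inv_mul, le_div_iff₀ hr]
      nlinarith
  have harctan : Tendsto Real.arctan atTop (𝓝 (Real.pi / 2)) :=
    Real.tendsto_arctan_atTop.mono_right nhdsWithin_le_nhds
  convert (harctan.sub h).div_const 2 using 2
  ring

lemma integrableOn_Ioi_sq_mul_inv_one_add_sq_sq :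
    IntegrableOn (fun r : ℝ => r ^ 2 * ((1 + r ^ 2) ^ 2)⁻¹) (Ioi 0) :=
  integrableOn_Ioi_deriv_of_nonneg' (fun r _ => hasDerivAt_half_arctan_sub_div r)
    (fun _ _ => by positivity) tendsto_half_arctan_sub_div

lemma integral_Ioi_sq_mul_inv_one_add_sq_sq :
    ∫ r in Ioi (0 : ℝ), r ^ 2 * ((1 + r ^ 2) ^ 2)⁻¹ = Real.pi / 4 := by
  rw [integral_Ioi_of_hasDerivAt_of_nonneg' (fun r _ => hasDerivAt_half_arctan_sub_div r)
    (fun _ _ => by positivity) tendsto_half_arctan_sub_div]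
  simp

lemma integrable_inv_one_add_enorm3_sq_sq :
    Integrable (fun x : Fin 3 → ℝ => ((1 + enorm3 x ^ 2) ^ 2)⁻¹) := by
  have h : Integrable (fun x : EuclideanSpace ℝ (Fin 3) => ((1 + ‖x‖ ^ 2) ^ 2)⁻¹) := by
    rw [integrable_fun_norm_addHaar volume (f := fun r : ℝ => ((1 + r ^ 2) ^ 2)⁻¹)]
    simpa using integrableOn_Ioi_sq_mul_inv_one_add_sq_sq
  simpa only [enorm3_eq_norm_toLp, Function.comp_def] using
    ((PiLp.volume_preserving_toLp (Fin 3)).integrable_comp_emb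
      (MeasurableEquiv.toLp 2 _).measurableEmbedding).2 h

lemma integral_inv_one_add_enorm3_sq_sq :
    ∫ x : Fin 3 → ℝ, ((1 + enorm3 x ^ 2) ^ 2)⁻¹ = Real.pi ^ 2 := by
  simp only [enorm3_eq_norm_toLp]
  rw [(PiLp.volume_preserving_toLp (Fin 3)).integral_comp
      (MeasurableEquiv.toLp 2 _).measurableEmbedding
      (fun x : EuclideanSpace ℝ (Fin 3) => ((1 + ‖x‖ ^ 2) ^ 2)⁻¹),
    integral_fun_norm_addHaar volume (fun r : ℝ => ((1 + r ^ 2) ^ 2)⁻¹), Measure.real,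
    EuclideanSpace.volume_ball_fin_three]
  simp only [finrank_euclideanSpace, Fintype.card_fin, smul_eq_mul, Nat.add_one_sub_one,
    integral_Ioi_sq_mul_inv_one_add_sq_sq, ENNReal.ofReal_one, one_pow, one_mul, nsmul_eq_mul]
  rw [ENNReal.toReal_ofReal (by positivity)]
  push_cast
  ring

lemma fderiv_const_mul_comp_smul {E : Type*} [NormedAddCommGroup E] [NormedSpace ℝ E]
    (a s : ℝ) (w : E → ℝ) (x v : E) :
    fderiv ℝ (fun y => a * w (s • y)) x v = a * s * fderiv ℝ w (s • x) v := by
  have h : (fun y => a * w (s • y)) = a • fun y => w (s • y) := rfl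
  rw [h, fderiv_const_smul_field, Pi.smul_apply, fderiv_comp_smul]
  simp [mul_assoc]

/-- for a Lipschitz `w` with `|∇w(x)| ≤ C₀/(1+|x|²)` a.e., the `H¹`-bound
`∫_{[−1/2,1/2]³} |∇_x ( N w(N^{1−κ}x) )|² dx ≤ π² C₀² N^{1+κ}` holds; the (Euclidean) squared
gradient norm is expressed through the partial derivatives along the coordinate directions. -/
theorem scaled_gradient_square_integral_bound
    (C₀ κ N : ℝ) (hC₀ : 0 < C₀) (hκ0 : 0 < κ) (hκ1 : κ < 1) (hN : 1 ≤ N)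
    (w : (Fin 3 → ℝ) → ℝ) (hLip : ∃ L : NNReal, LipschitzWith L w)
    (hgrad : ∀ᵐ x ∂(volume : Measure (Fin 3 → ℝ)),
      Real.sqrt (∑ k : Fin 3, (fderiv ℝ w x (Pi.single k (1 : ℝ))) ^ 2)
        ≤ C₀ / (1 + enorm3 x ^ 2)) :
    (∫ x in boxSym, ∑ k : Fin 3,
        (fderiv ℝ (fun y => N * w (N ^ (1 - κ) • y)) x (Pi.single k (1 : ℝ))) ^ 2)
      ≤ Real.pi ^ 2 * C₀ ^ 2 * N ^ (1 + κ) := by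
  set s : ℝ := N ^ (1 - κ) with hs
  have hNpos : 0 < N := by linarith
  have hspos : 0 < s := Real.rpow_pos_of_pos hNpos _
  have hbound : ∀ᵐ x ∂(volume : Measure (Fin 3 → ℝ)),
      ∑ k : Fin 3, (fderiv ℝ (fun y => N * w (s • y)) x (Pi.single k (1 : ℝ))) ^ 2
        ≤ (N * s) ^ 2 * C₀ ^ 2 * ((1 + enorm3 (s • x) ^ 2) ^ 2)⁻¹ := by
    filter_upwards [(Measure.quasiMeasurePreserving_smul volume hspos.ne').ae hgrad] with x hx
    simp only [fderiv_const_mul_comp_smul, mul_pow (N * s), ← Finset.mul_sum]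
    rw [Real.sqrt_le_left (by positivity), div_pow] at hx
    rw [mul_assoc, ← div_eq_mul_inv]
    gcongr
  have hint : Integrable (fun x : Fin 3 → ℝ =>
      (N * s) ^ 2 * C₀ ^ 2 * ((1 + enorm3 (s • x) ^ 2) ^ 2)⁻¹) :=
    ((integrable_comp_smul_iff volume _ hspos.ne').2
      integrable_inv_one_add_enorm3_sq_sq).const_mul _
  calc
    _ ≤ ∫ x in boxSym, (N * s) ^ 2 * C₀ ^ 2 * ((1 + enorm3 (s • x) ^ 2) ^ 2)⁻¹ :=
      integral_mono_of_nonneg (ae_of_all _ fun _ => Finset.sum_nonneg fun _ _ => sq_nonneg _)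
        hint.integrableOn (ae_restrict_of_ae hbound)
    _ ≤ ∫ x, (N * s) ^ 2 * C₀ ^ 2 * ((1 + enorm3 (s • x) ^ 2) ^ 2)⁻¹ :=
      setIntegral_le_integral hint (ae_of_all _ fun _ => by positivity)
    _ = Real.pi ^ 2 * C₀ ^ 2 * (N ^ 2 / s) := by
      rw [integral_const_mul, Measure.integral_comp_smul volume
        (fun x : Fin 3 → ℝ => ((1 + enorm3 x ^ 2) ^ 2)⁻¹), integral_inv_one_add_enorm3_sq_sq,
        Module.finrank_fin_fun, abs_of_pos (by positivity), smul_eq_mul]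
      field_simp
    _ = Real.pi ^ 2 * C₀ ^ 2 * N ^ (1 + κ) := by
      rw [hs, ← Real.rpow_natCast N 2, ← Real.rpow_sub hNpos]
      congr 2
      push_cast
      ring

end
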